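/- arXiv:1605.09736 — 7 statements merged into one kernel-verified Lean document; each statement's English description precedes it below -/
import Mathlib

section
/- Let n ≥ 2 be an integer, p ∈ {1,…,n−1} with gcd(n,p) = 1, and q ∈ {1,…,n−1} with pq ≡ 1 (mod n). Then the (n−1)×(n−1) integer matrix Ω = B − C satisfies A·Ωᵀ = I_{n−1}; in particular A is invertible over the integers and Ω is the transpose of A⁻¹. -/
open Finset Matrix
open scoped BigOperators Real

noncomputable section

/-- Entries of the `(n-1) × (n-1)` integer matrix `A` (1-based indices):
`A_{j,k} = 1` if `1 ≤ j ≤ n-p` and `j ≤ k < j+p`, `A_{j,k} = -1` if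
`n-p < j ≤ n-1` and `j+p-n ≤ k < j`, and `0` otherwise. -/
def Aent (n p : ℕ) (j k : ℕ) : ℤ :=
  if j ≤ n - p ∧ j ≤ k ∧ k < j + p then 1
  else if n - p < j ∧ j + p ≤ k + n ∧ k < j then -1
  else 0

open Classical in
/-- Entries of the binary matrix `B`: `B_{m,k} = 0` iff `k - m ≡ ℓ p (mod n)`
for some `ℓ ∈ {1, …, n-q}`, else `1`. -/
def Bent (n p q : ℕ) (m k : ℕ) : ℤ :=
  if ∃ ℓ ∈ Finset.Icc 1 (n - q), ((k : ℤ) - (m : ℤ)) ≡ ((ℓ * p : ℕ) : ℤ) [ZMOD (n : ℤ)]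
  then 0 else 1

open Classical in
/-- Entries of the binary matrix `C`: `C_{m,k} = 0` iff `k ≡ ℓ p (mod n)`
for some `ℓ ∈ {1, …, n-q}`, else `1`. -/
def Cent (n p q : ℕ) (m k : ℕ) : ℤ :=
  if ∃ ℓ ∈ Finset.Icc 1 (n - q), ((k : ℤ)) ≡ ((ℓ * p : ℕ) : ℤ) [ZMOD (n : ℤ)]
  then 0 else 1

/-- Entries of `Ω = B - C`. -/
def Ωent (n p q : ℕ) (m k : ℕ) : ℤ := Bent n p q m k - Cent n p q m k

/-- The matrix `A` as an `(n-1) × (n-1)` integer matrix. -/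
def Amat (n p : ℕ) : Matrix (Fin (n - 1)) (Fin (n - 1)) ℤ :=
  fun j k => Aent n p (j.1 + 1) (k.1 + 1)

/-- The matrix `Ω = B - C` as an `(n-1) × (n-1)` integer matrix. -/
def Ωmat (n p q : ℕ) : Matrix (Fin (n - 1)) (Fin (n - 1)) ℤ :=
  fun j k => Ωent n p q (j.1 + 1) (k.1 + 1)

/-- Cyclic window sum `ξ_ℓ + ξ_{ℓ+1} + ⋯ + ξ_{ℓ+d-1}`. -/
def wsum (ξ : ℕ → ℝ) (ℓ d : ℕ) : ℝ := ∑ m ∈ Finset.range d, ξ (ℓ + m)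

/-- First type (i) interval: `(p/n - 1/(nq))π < y < pπ/n` (so `M = pπ - ny > 0`). -/
def typeI1 (n p q : ℕ) (y : ℝ) : Prop :=
  ((p : ℝ) / n - 1 / ((n : ℝ) * q)) * Real.pi < y ∧ y < (p : ℝ) * Real.pi / n

/-- Second type (i) interval: `pπ/n < y < (p/n + 1/(n(n-q)))π` (so `M = pπ - ny < 0`). -/
def typeI2 (n p q : ℕ) (y : ℝ) : Prop :=
  (p : ℝ) * Real.pi / n < y ∧ y < ((p : ℝ) / n + 1 / ((n : ℝ) * ((n : ℝ) - q))) * Real.pi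

/-- `M = pπ - ny`. -/
def Mval (n p : ℕ) (y : ℝ) : ℝ := (p : ℝ) * Real.pi - (n : ℝ) * y

/-- Membership of `ξ` (a cyclic sequence of reals, indices `1, …, n`) in the open
domain `A_y^+`: cyclic convention `ξ_{m+n} = ξ_m`, positivity, total sum `π`, and
`sgn(M)(ξ_j + ⋯ + ξ_{j+p-1} - y) > 0` for `j = 1, …, n`. -/
def inAy (n p : ℕ) (y : ℝ) (ξ : ℕ → ℝ) : Prop :=
  (∀ m, ξ (m + n) = ξ m) ∧
  (∀ k, 1 ≤ k → k ≤ n → 0 < ξ k) ∧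
  (∑ k ∈ Finset.Icc 1 n, ξ k = Real.pi) ∧
  (∀ j, 1 ≤ j → j ≤ n → 0 < Real.sign (Mval n p y) * (wsum ξ j p - y))

/-- `|u_j(ξ)|² = sgn(M) (ξ_j + ⋯ + ξ_{j+p-1} - y)`. -/
def usq (n p : ℕ) (y : ℝ) (ξ : ℕ → ℝ) (j : ℕ) : ℝ :=
  Real.sign (Mval n p y) * (wsum ξ j p - y)

/-- `z_ℓ(ξ, w) = sgn(sin(ny)) ∏_{d=1}^{n-1} sin(ξ_ℓ + ⋯ + ξ_{ℓ+d-1} - w)/sin(ξ_ℓ + ⋯ + ξ_{ℓ+d-1})`;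
the paper's `z_ℓ(ξ, ±y)` is obtained at `w = ±y`. -/
def zfun (n : ℕ) (y : ℝ) (ξ : ℕ → ℝ) (w : ℝ) (ℓ : ℕ) : ℝ :=
  Real.sign (Real.sin ((n : ℝ) * y)) *
    ∏ d ∈ Finset.Icc 1 (n - 1), Real.sin (wsum ξ ℓ d - w) / Real.sin (wsum ξ ℓ d)

/-- `x_j - x_ℓ` expressed through `ξ`: `ξ_ℓ + ⋯ + ξ_{j-1}` for `ℓ ≤ j`, antisymmetric. -/
def xdiff (ξ : ℕ → ℝ) (j ℓ : ℕ) : ℝ :=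
  if ℓ ≤ j then wsum ξ ℓ (j - ℓ) else -(wsum ξ j (ℓ - j))

/-- `ρ(θ)_ℓ = exp(i(θ_{ℓ-1} - θ_ℓ))` (with the conventions `θ_0 = θ_n = 0` imposed
as hypotheses on `θ`). -/
def ρfun (θ : ℕ → ℝ) (ℓ : ℕ) : ℂ :=
  Complex.exp (Complex.I * ((θ (ℓ - 1) - θ ℓ : ℝ) : ℂ))

/-- `Δ_j(θ) = exp(i Σ_{k=1}^{n-1} Ω_{j,k} θ_k)` for `1 ≤ j ≤ n-1`, and `Δ_n(θ) = 1`. -/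
def Δfun (n p q : ℕ) (θ : ℕ → ℝ) (j : ℕ) : ℂ :=
  if j = n then 1
  else Complex.exp (Complex.I *
    ((∑ k ∈ Finset.Icc 1 (n - 1), (Ωent n p q j k : ℝ) * θ k : ℝ) : ℂ))

/-- The local trigonometric Lax matrix
`L(ξ,θ)_{j,ℓ} = [sin y / sin(x_j - x_ℓ + y)] v_j(ξ,y) v_ℓ(ξ,-y) ρ(θ)_ℓ`. -/
def Lloc (n : ℕ) (y : ℝ) (ξ θ : ℕ → ℝ) (j ℓ : ℕ) : ℂ :=
  ((Real.sin y / Real.sin (xdiff ξ j ℓ + y) : ℝ) : ℂ) *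
    ((Real.sqrt (zfun n y ξ y j) : ℝ) : ℂ) *
    ((Real.sqrt (zfun n y ξ (-y) ℓ) : ℝ) : ℂ) * ρfun θ ℓ

/-- The embedding map `ℰ(ξ,θ)_j = |u_j(ξ)| Δ_j(θ)^{sgn M}` for `j = 1, …, n-1`
and `ℰ(ξ,θ)_n = |u_n(ξ)|` (note `Δ_n = 1`). -/
def Emap (n p q : ℕ) (y : ℝ) (ξ θ : ℕ → ℝ) (j : ℕ) : ℂ :=
  ((Real.sqrt (usq n p y ξ j) : ℝ) : ℂ) *
    Δfun n p q θ j ^ (if 0 < Mval n p y then (1 : ℤ) else -1)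

/-- `σ(ℓ) = ℓ + n - p` if `1 ≤ ℓ ≤ p`, and `σ(ℓ) = ℓ - p` if `p < ℓ ≤ n`. -/
def σmap (n p : ℕ) (ℓ : ℕ) : ℕ := if ℓ ≤ p then ℓ + n - p else ℓ - p

/-- The Weierstrass-type function
`ws_b(z) = sin z ∏_{m=1}^∞ (1 + sin² z / sinh²(2 m b))` with `ω = π/2`, `ω' = i b`. -/
def wsb (b : ℝ) (z : ℂ) : ℂ :=
  Complex.sin z *
    ∏' m : ℕ, (1 + Complex.sin z ^ 2 / Complex.sinh (2 * ((m : ℂ) + 1) * (b : ℂ)) ^ 2)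

/-- Elliptic analogue of `zfun`, built from `ws_b` instead of `sin`. -/
def zbfun (b : ℝ) (n : ℕ) (y : ℝ) (ξ : ℕ → ℝ) (w : ℝ) (ℓ : ℕ) : ℝ :=
  Real.sign ((wsb b (((n : ℝ) * y : ℝ) : ℂ)).re) *
    ∏ d ∈ Finset.Icc 1 (n - 1),
      (wsb b ((wsum ξ ℓ d - w : ℝ) : ℂ)).re / (wsb b ((wsum ξ ℓ d : ℝ) : ℂ)).re

/-- The local elliptic Lax matrix with spectral parameter `lam`. -/
def Lbloc (b : ℝ) (n : ℕ) (y : ℝ) (lam : ℂ) (ξ θ : ℕ → ℝ) (j ℓ : ℕ) : ℂ :=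
  (wsb b ((y : ℝ) : ℂ) / wsb b lam) *
    (wsb b (((xdiff ξ j ℓ : ℝ) : ℂ) + lam) / wsb b ((xdiff ξ j ℓ + y : ℝ) : ℂ)) *
    ((Real.sqrt (zbfun b n y ξ y j) : ℝ) : ℂ) *
    ((Real.sqrt (zbfun b n y ξ (-y) ℓ) : ℝ) : ℂ) * ρfun θ ℓ

/-- The subset `S = {ℓ p mod n : ℓ = 1, …, n-q}` of `ℤ/nℤ`. -/
def Sset (n p q : ℕ) : Finset (ZMod n) :=
  (Finset.Icc 1 (n - q)).image (fun ℓ => ((ℓ * p : ℕ) : ZMod n))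

/-- The subset `S_i = {i + ℓ mod n : ℓ = 0, …, p-1}` of `ℤ/nℤ`. -/
def Siset (n p : ℕ) (i : ZMod n) : Finset (ZMod n) :=
  (Finset.range p).image (fun ℓ : ℕ => i + (ℓ : ZMod n))

/-- `I_i = |S_i ∩ S|`. -/
def Inum (n p q : ℕ) (i : ZMod n) : ℕ := (Siset n p i ∩ Sset n p q).card

/-- The function `W_j(ξ)` of Statement 13. -/
def Wfun (n p : ℕ) (y : ℝ) (ξ : ℕ → ℝ) (j : ℕ) : ℝ :=
  (Real.sin (usq n p y ξ j) / usq n p y ξ j) *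
    ((-1 : ℝ) ^ (p - 1) / Real.sin (wsum ξ j p)) *
    ∏ d ∈ (Finset.Icc 1 (n - 1)).erase p,
      Real.sin (wsum ξ j d - y) / Real.sin (wsum ξ j d)

theorem ZMod.eq_apply_zero_of_apply_add_one {n : ℕ} [NeZero n] {α : Type*} {f : ZMod n → α}
    (h : ∀ x, f (x + 1) = f x) (x : ZMod n) : f x = f 0 := by
  obtain ⟨k, rfl⟩ := ZMod.natCast_zmod_surjective x
  induction k with
  | zero => simp
  | succ k ih => rw [Nat.cast_succ, h, ih]

/-- Sum of `F` over the window `x, x + 1, …, x + d - 1` of `ℤ/nℤ`. -/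
def windowSum {n : ℕ} (F : ZMod n → ℤ) (d : ℕ) (x : ZMod n) : ℤ :=
  ∑ i ∈ Finset.range d, F (x + (i : ZMod n))

theorem windowSum_add_one {n : ℕ} (F : ZMod n → ℤ) (d : ℕ) (x : ZMod n) :
    windowSum F d (x + 1) = windowSum F d x + F (x + d) - F x := by
  have h1 := Finset.sum_range_succ (fun i : ℕ => F (x + (i : ZMod n))) d
  have h2 := Finset.sum_range_succ' (fun i : ℕ => F (x + (i : ZMod n))) d
  have h3 : windowSum F d (x + 1) = ∑ i ∈ Finset.range d, F (x + ((i + 1 : ℕ) : ZMod n)) :=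
    Finset.sum_congr rfl fun i _ => by congr 1; push_cast; ring
  simp only [Nat.cast_zero, add_zero] at h2
  rw [h3]
  unfold windowSum
  linarith

theorem windowSum_period {n : ℕ} [NeZero n] (F : ZMod n → ℤ) (x : ZMod n) :
    windowSum F n x = windowSum F n 0 :=
  ZMod.eq_apply_zero_of_apply_add_one (fun y => by simp [windowSum_add_one]) x

/-- Number of `ℓ ∈ {1, …, n - q}` with `x = ℓ p` in `ℤ/nℤ`. -/
def multCount (n p q : ℕ) (x : ZMod n) : ℤ :=
  ∑ ℓ ∈ Finset.range (n - q), if x = (((ℓ + 1) * p : ℕ) : ZMod n) then 1 else 0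

theorem multCount_eq_ite {n p q : ℕ} (hq1 : 1 ≤ q) (hgcd : Nat.gcd n p = 1) (x : ZMod n)
    [Decidable (∃ ℓ ∈ Finset.Icc 1 (n - q), x = ((ℓ * p : ℕ) : ZMod n))] :
    multCount n p q x =
      if ∃ ℓ ∈ Finset.Icc 1 (n - q), x = ((ℓ * p : ℕ) : ZMod n) then 1 else 0 := by
  unfold multCount
  split_ifs with h
  · obtain ⟨ℓ, hℓ, rfl⟩ := h
    rw [Finset.mem_Icc] at hℓ
    rw [Finset.sum_eq_single (ℓ - 1)]
    · rw [Nat.sub_add_cancel hℓ.1, if_pos rfl]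
    · intro b hb hne
      rw [Finset.mem_range] at hb
      refine if_neg fun h => hne ?_
      rw [ZMod.natCast_eq_natCast_iff] at h
      have h' := Nat.ModEq.cancel_right_of_coprime hgcd h
      have := h'.eq_of_lt_of_lt (by omega) (by omega)
      omega
    · intro h
      exact absurd (Finset.mem_range.2 (by omega)) h
  · refine Finset.sum_eq_zero fun ℓ hℓ => if_neg fun hx => h ⟨ℓ + 1, ?_, hx⟩
    rw [Finset.mem_range] at hℓ
    exact Finset.mem_Icc.2 ⟨by omega, by omega⟩

theorem natCast_sub_mul_eq_neg_one {n p q : ℕ} (hqn : q ≤ n) (hpq : p * q ≡ 1 [MOD n]) :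
    (((n - q) * p : ℕ) : ZMod n) = -1 := by
  have h := (ZMod.natCast_eq_natCast_iff _ _ _).2 hpq
  push_cast [Nat.cast_sub hqn] at h ⊢
  rw [ZMod.natCast_self, ← h]
  ring

theorem multCount_add {n p q : ℕ} (hqn : q ≤ n) (hpq : p * q ≡ 1 [MOD n]) (x : ZMod n) :
    multCount n p q (x + p) =
      multCount n p q x + (if x = 0 then 1 else 0) - (if x + 1 = 0 then 1 else 0) := by
  have h1 : multCount n p q (x + p) =
      ∑ ℓ ∈ Finset.range (n - q), if x = ((ℓ * p : ℕ) : ZMod n) then 1 else 0 := by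
    refine Finset.sum_congr rfl fun ℓ _ => ?_
    have : x + p = (((ℓ + 1) * p : ℕ) : ZMod n) ↔ x = ((ℓ * p : ℕ) : ZMod n) := by
      rw [add_mul, one_mul, Nat.cast_add, add_left_inj]
    simp only [this]
  have h2 := Finset.sum_range_succ
    (fun ℓ : ℕ => if x = ((ℓ * p : ℕ) : ZMod n) then (1 : ℤ) else 0) (n - q)
  have h3 := Finset.sum_range_succ'
    (fun ℓ : ℕ => if x = ((ℓ * p : ℕ) : ZMod n) then (1 : ℤ) else 0) (n - q)
  rw [natCast_sub_mul_eq_neg_one hqn hpq] at h2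
  simp only [zero_mul, Nat.cast_zero] at h3
  simp only [← eq_neg_iff_add_eq_zero]
  rw [h1]
  unfold multCount
  linarith

theorem windowSum_multCount {n p q : ℕ} [NeZero n] (hqn : q ≤ n) (hpq : p * q ≡ 1 [MOD n])
    (x : ZMod n) :
    windowSum (multCount n p q) p x + (if x = 0 then 1 else 0) =
      windowSum (multCount n p q) p 0 + 1 := by
  have := ZMod.eq_apply_zero_of_apply_add_one
    (f := fun x => windowSum (multCount n p q) p x + (if x = 0 then 1 else 0))
    (fun y => by
      simp only [windowSum_add_one, multCount_add hqn hpq]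
      ring) x
  simpa using this

theorem Ωent_eq {n p q : ℕ} (hq1 : 1 ≤ q) (hgcd : Nat.gcd n p = 1) (m k : ℕ) :
    Ωent n p q m k = multCount n p q k - multCount n p q (k - m) := by
  classical
  have hB : Bent n p q m k = 1 - multCount n p q (k - m) := by
    rw [multCount_eq_ite hq1 hgcd, Bent]
    simp only [← ZMod.intCast_eq_intCast_iff]
    push_cast
    split_ifs <;> simp
  have hC : Cent n p q m k = 1 - multCount n p q k := by
    rw [multCount_eq_ite hq1 hgcd, Cent]
    simp only [← ZMod.intCast_eq_intCast_iff]
    push_cast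
    split_ifs <;> simp
  rw [Ωent, hB, hC]
  ring

/-- If `g` sums to zero over `ℤ/nℤ`, then each row of `A` acts on it as a cyclic window sum. -/
theorem sum_Aent_mul {n p j : ℕ} [NeZero n] (hpn : p < n) (hj1 : 1 ≤ j) (hjn : j < n)
    (g : ZMod n → ℤ) (hg : windowSum g n 0 = 0) :
    ∑ k ∈ Finset.Ico 1 n, Aent n p j k * g k = windowSum g p j := by
  have hw (a d : ℕ) : windowSum g d a = ∑ k ∈ Finset.Ico a (a + d), g k := by
    rw [Finset.sum_Ico_eq_sum_range, Nat.add_sub_cancel_left]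
    simp [windowSum]
  by_cases hj : j ≤ n - p
  · rw [hw, ← Finset.sum_subset (s₁ := Finset.Ico j (j + p))]
    · refine Finset.sum_congr rfl fun k hk => ?_
      rw [Finset.mem_Ico] at hk
      rw [Aent, if_pos ⟨hj, hk⟩, one_mul]
    · exact Finset.Ico_subset_Ico hj1 (by omega)
    · intro k _ hk
      rw [Finset.mem_Ico] at hk
      rw [Aent, if_neg (by tauto), if_neg (by omega), zero_mul]
  · have htot := (hw (j + p - n) n).symm.trans ((windowSum_period g _).trans hg)
    rw [← Finset.sum_Ico_consecutive _ (show j + p - n ≤ j by omega)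
      (show j ≤ j + p - n + n by omega), Nat.sub_add_cancel (by omega)] at htot
    rw [hw, ← Finset.sum_subset (s₁ := Finset.Ico (j + p - n) j)]
    · have : ∑ k ∈ Finset.Ico (j + p - n) j, Aent n p j k * g k =
          ∑ k ∈ Finset.Ico (j + p - n) j, -g k := by
        refine Finset.sum_congr rfl fun k hk => ?_
        rw [Finset.mem_Ico] at hk
        rw [Aent, if_neg (by omega), if_pos (by omega), neg_one_mul]
      rw [this, Finset.sum_neg_distrib]
      linarith
    · exact Finset.Ico_subset_Ico (by omega) (by omega)
    · intro k _ hk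
      rw [Finset.mem_Ico] at hk
      rw [Aent, if_neg (by omega), if_neg (by omega), zero_mul]

theorem windowSum_sub_translate {n : ℕ} (F : ZMod n → ℤ) (m : ZMod n) (d : ℕ) (x : ZMod n) :
    windowSum (fun k => F k - F (k - m)) d x = windowSum F d x - windowSum F d (x - m) := by
  simp only [windowSum, Finset.sum_sub_distrib, add_sub_right_comm]

theorem sum_Aent_mul_Ωent {n p q j m : ℕ} (hpn : p < n) (hgcd : Nat.gcd n p = 1)
    (hq1 : 1 ≤ q) (hqn : q ≤ n) (hpq : p * q ≡ 1 [MOD n])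
    (hj1 : 1 ≤ j) (hjn : j < n) (hmn : m < n) :
    ∑ k ∈ Finset.Ico 1 n, Aent n p j k * Ωent n p q m k = if j = m then 1 else 0 := by
  have : NeZero n := ⟨by omega⟩
  simp only [Ωent_eq hq1 hgcd]
  rw [sum_Aent_mul hpn hj1 hjn (fun k => multCount n p q k - multCount n p q (k - m)),
    windowSum_sub_translate]
  · have h1 := windowSum_multCount hqn hpq (j : ZMod n)
    have h2 := windowSum_multCount hqn hpq ((j : ZMod n) - m)
    have hj0 : (j : ZMod n) ≠ 0 := by
      rw [Ne, ZMod.natCast_eq_zero_iff]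
      exact Nat.not_dvd_of_pos_of_lt hj1 hjn
    have hjm : (j : ZMod n) - m = 0 ↔ j = m := by
      rw [sub_eq_zero, ZMod.natCast_eq_natCast_iff]
      exact ⟨fun h => h.eq_of_lt_of_lt hjn hmn, fun h => h ▸ Nat.ModEq.refl _⟩
    rw [if_neg hj0] at h1
    simp only [hjm] at h2
    linarith
  · rw [windowSum_sub_translate, windowSum_period _ (0 - _), sub_self]

theorem Amat_mul_transpose_Ωmat {n p q : ℕ} (hpn : p < n) (hgcd : Nat.gcd n p = 1)
    (hq1 : 1 ≤ q) (hqn : q ≤ n) (hpq : p * q ≡ 1 [MOD n]) :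
    Amat n p * (Ωmat n p q)ᵀ = 1 := by
  ext j m
  have h := sum_Aent_mul_Ωent hpn hgcd hq1 hqn hpq (j := j + 1) (m := m + 1)
    (by omega) (by omega) (by omega)
  rw [Finset.sum_Ico_eq_sum_range, Finset.sum_range] at h
  simp only [add_comm 1, add_left_inj, Fin.val_inj] at h
  rw [Matrix.mul_apply, Matrix.one_apply]
  exact h

/-- `A · Ωᵀ = 1`; in particular `A` is invertible over `ℤ`
and `Ω` is the transpose of `A⁻¹`. -/
theorem stmt0 (n p q : ℕ) (hn : 2 ≤ n) (hp1 : 1 ≤ p) (hpn : p ≤ n - 1)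
    (hgcd : Nat.gcd n p = 1) (hq1 : 1 ≤ q) (hqn : q ≤ n - 1)
    (hpq : p * q ≡ 1 [MOD n]) :
    Amat n p * (Ωmat n p q)ᵀ = 1 ∧
    IsUnit (Amat n p).det ∧
    Ωmat n p q = ((Amat n p)⁻¹)ᵀ := by
  have h := Amat_mul_transpose_Ωmat (by omega) hgcd hq1 (by omega) hpq
  refine ⟨h, (Amat n p).isUnit_det_of_right_inverse h, ?_⟩
  rw [Matrix.inv_eq_right_inv h, Matrix.transpose_transpose]
end
end

section
/- Let n ≥ 2 be an integer, p ∈ {1,…,n−1} with gcd(n,p) = 1, and q ∈ {1,…,n−1} with pq ≡ 1 (mod n). For i ∈ ℤ/nℤ let I_i = |S_i ∩ S|. Then I_i = I_1 for every i ∈ {1,…,n−1}, and I_0 = I_1 − 1 (i.e. I_1 = I_2 = ⋯ = I_{n−1} = I_n + 1, where I_n means I_0). -/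
open Finset Matrix
open scoped BigOperators Real

noncomputable section

theorem mem_Sset {n p q : ℕ} {x : ZMod n} :
    x ∈ Sset n p q ↔ ∃ ℓ : ℕ, 1 ≤ ℓ ∧ ℓ ≤ n - q ∧ (ℓ : ZMod n) * p = x := by
  simp [Sset, and_assoc]

theorem Inum_eq_sum {n p : ℕ} (q : ℕ) (hpn : p ≤ n) (i : ZMod n) :
    Inum n p q i = ∑ ℓ ∈ range p, if i + (ℓ : ZMod n) ∈ Sset n p q then 1 else 0 := by
  rw [Inum, Siset, ← filter_mem_eq_inter, filter_image, card_image_of_injOn, card_filter]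
  intro a ha b hb hab
  simp only [coe_filter, mem_range, Set.mem_ofPred_eq] at ha hb
  have h := (ZMod.natCast_eq_natCast_iff' a b n).1 (add_left_cancel hab)
  rwa [Nat.mod_eq_of_lt (by omega), Nat.mod_eq_of_lt (by omega)] at h

theorem Inum_add_one {n p : ℕ} (q : ℕ) (hpn : p ≤ n) (i : ZMod n) :
    Inum n p q (i + 1) + (if i ∈ Sset n p q then 1 else 0) =
      Inum n p q i + (if i + (p : ZMod n) ∈ Sset n p q then 1 else 0) := by
  rw [Inum_eq_sum q hpn, Inum_eq_sum q hpn,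
    ← sum_range_succ (fun ℓ : ℕ => if i + (ℓ : ZMod n) ∈ Sset n p q then 1 else 0), sum_range_succ']
  simp [add_assoc, add_comm (1 : ZMod n)]

theorem zero_notMem_Sset {n p q : ℕ} (hgcd : Nat.gcd n p = 1) (hq : 1 ≤ q) :
    (0 : ZMod n) ∉ Sset n p q := by
  rw [mem_Sset]
  rintro ⟨ℓ, h1, h2, h⟩
  have hdvd : n ∣ ℓ * p := (ZMod.natCast_eq_zero_iff _ _).1 (by exact_mod_cast h)
  have := Nat.le_of_dvd h1 (Nat.Coprime.dvd_of_dvd_mul_right hgcd hdvd)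
  omega

theorem natCast_mem_Sset {n p q : ℕ} (hq : q < n) : (p : ZMod n) ∈ Sset n p q :=
  mem_Sset.2 ⟨1, le_rfl, by omega, by simp⟩

theorem add_natCast_mem_Sset_iff {n p q : ℕ} (hqn : q ≤ n) (hpq : p * q ≡ 1 [MOD n])
    {x : ZMod n} (h0 : x ≠ 0) (h1 : x + 1 ≠ 0) :
    x + (p : ZMod n) ∈ Sset n p q ↔ x ∈ Sset n p q := by
  simp only [mem_Sset]
  constructor
  · rintro ⟨ℓ, hℓ, hℓ', h⟩
    obtain ⟨k, rfl⟩ := Nat.exists_eq_add_of_le' hℓ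
    have hk : (k : ZMod n) * p = x := by
      push_cast at h
      linear_combination h
    refine ⟨k, Nat.one_le_iff_ne_zero.2 ?_, by omega, hk⟩
    rintro rfl
    exact h0 (by simpa using hk.symm)
  · rintro ⟨ℓ, hℓ, hℓ', rfl⟩
    have hne : ℓ ≠ n - q := by
      rintro rfl
      have hc : (p : ZMod n) * q = 1 := by
        simpa using (ZMod.natCast_eq_natCast_iff _ _ _).2 hpq
      apply h1
      rw [Nat.cast_sub hqn, ZMod.natCast_self]
      linear_combination -hc
    exact ⟨ℓ + 1, by omega, by omega, by push_cast; ring⟩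

/-- `I_i = I_1` for every `i ∈ {1, …, n-1}` and `I_0 = I_1 - 1`
(i.e. `I_1 = ⋯ = I_{n-1} = I_n + 1`, where `I_n` means `I_0`). -/
theorem stmt1 (n p q : ℕ) (hn : 2 ≤ n) (hp1 : 1 ≤ p) (hpn : p ≤ n - 1)
    (hgcd : Nat.gcd n p = 1) (hq1 : 1 ≤ q) (hqn : q ≤ n - 1)
    (hpq : p * q ≡ 1 [MOD n]) :
    (∀ i : ℕ, 1 ≤ i → i ≤ n - 1 → Inum n p q (i : ZMod n) = Inum n p q (1 : ZMod n)) ∧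
    Inum n p q (1 : ZMod n) = Inum n p q (0 : ZMod n) + 1 := by
  constructor
  · intro i hi
    induction i, hi using Nat.le_induction with
    | base => simp
    | succ i hi ih =>
      intro hin
      have h0 : (i : ZMod n) ≠ 0 := fun h =>
        absurd (Nat.le_of_dvd hi ((ZMod.natCast_eq_zero_iff _ _).1 h)) (by omega)
      have h1 : (i : ZMod n) + 1 ≠ 0 := fun h =>
        absurd (Nat.le_of_dvd (Nat.succ_pos i)
          ((ZMod.natCast_eq_zero_iff (i + 1) n).1 (by exact_mod_cast h))) (by omega)
      have h := Inum_add_one q (show p ≤ n by omega) (i : ZMod n)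
      simp only [add_natCast_mem_Sset_iff (show q ≤ n by omega) hpq h0 h1] at h
      rw [← ih (by omega), Nat.cast_succ]
      exact Nat.add_right_cancel h
  · have h := Inum_add_one q (show p ≤ n by omega) (0 : ZMod n)
    simpa [zero_notMem_Sset hgcd hq1,
      natCast_mem_Sset (p := p) (show q < n by omega)] using h

end
end

section
/- Let n ≥ 2 be an integer and p ∈ {1,…,n−1} with gcd(n,p) = 1. Then det(A) = 1, where A is the (n−1)×(n−1) integer matrix defined below. -/
open Finset Matrix
open scoped BigOperators Real

noncomputable section

/-- The matrix of `x ↦ (x_{i+s} - x_i)_i` on functions on `ℤ/nℤ`, with the row and the column of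
index `0` removed. -/
def shiftMinor (n : ℕ) (s : ZMod n) :
    Matrix {x : ZMod n // x ≠ 0} {x : ZMod n // x ≠ 0} ℤ :=
  fun i k => (if k.1 = i.1 + s then 1 else 0) - (if k.1 = i.1 then 1 else 0)

theorem det_shiftMinor_unit (n : ℕ) [NeZero n] (u : (ZMod n)ˣ) :
    (shiftMinor n u).det = (shiftMinor n 1).det := by
  let e : {x : ZMod n // x ≠ 0} ≃ {x : ZMod n // x ≠ 0} :=
    (Units.mulLeft u).subtypeEquiv fun x => by simp
  rw [← Matrix.det_submatrix_equiv_self e (shiftMinor n u)]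
  congr 1
  ext i k
  have h1 : (u : ZMod n) * k.1 = u * i.1 + u ↔ k.1 = i.1 + 1 := by
    rw [← Units.mul_right_inj u (b := k.1), mul_add, mul_one]
  simp [shiftMinor, e, h1]

/-- The indices `1, …, n - 1` enumerate the nonzero residues modulo `n`. -/
def nonzeroResidue (n : ℕ) (i : Fin (n - 1)) : {x : ZMod n // x ≠ 0} :=
  ⟨((i.1 + 1 : ℕ) : ZMod n), fun h => by
    have := Nat.le_of_dvd (by omega) ((ZMod.natCast_eq_zero_iff _ _).1 h)
    omega⟩

theorem nonzeroResidue_bijective (n : ℕ) [NeZero n] : Function.Bijective (nonzeroResidue n) := by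
  rw [Fintype.bijective_iff_injective_and_card]
  constructor
  · intro i k h
    have h' := (ZMod.natCast_eq_natCast_iff' _ _ _).1 (congrArg Subtype.val h)
    rw [Nat.mod_eq_of_lt (by omega), Nat.mod_eq_of_lt (by omega)] at h'
    exact Fin.ext (by omega)
  · simp [Fintype.card_subtype_compl, ZMod.card]

theorem natCast_eq_natCast_add_iff {n a b s : ℕ} (ha : a < n) (hb : b < n) (hs : s < n) :
    (a : ZMod n) = b + s ↔ a = b + s ∨ a + n = b + s := by
  rw [← Nat.cast_add, ZMod.natCast_eq_natCast_iff', Nat.mod_eq_of_lt ha]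
  rcases lt_or_ge (b + s) n with h | h
  · rw [Nat.mod_eq_of_lt h]
    omega
  · rw [Nat.mod_eq_sub_mod h, Nat.mod_eq_of_lt (by omega)]
    omega

theorem shiftMinor_nonzeroResidue {n s : ℕ} (hs : s < n) (i k : Fin (n - 1)) :
    shiftMinor n s (nonzeroResidue n i) (nonzeroResidue n k) =
      (if k.1 = i.1 + s ∨ k.1 + n = i.1 + s then 1 else 0) - (if k = i then 1 else 0) := by
  have h1 : (((k.1 + 1 : ℕ) : ZMod n) = ((i.1 + 1 : ℕ) : ZMod n) + s) ↔
      (k.1 = i.1 + s ∨ k.1 + n = i.1 + s) := by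
    rw [natCast_eq_natCast_add_iff (by omega) (by omega) hs]
    omega
  have h2 : (((k.1 + 1 : ℕ) : ZMod n) = ((i.1 + 1 : ℕ) : ZMod n)) ↔ k = i := by
    have := natCast_eq_natCast_add_iff (n := n) (a := k.1 + 1) (b := i.1 + 1) (s := 0)
      (by omega) (by omega) (by omega)
    rw [Nat.cast_zero, add_zero] at this
    rw [this, Fin.ext_iff]
    omega
  simp only [shiftMinor, nonzeroResidue, h1, h2]

theorem det_shiftMinor_one_ne_zero (n : ℕ) (hn : 2 ≤ n) [NeZero n] :
    (shiftMinor n 1).det ≠ 0 := by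
  rw [← Matrix.det_submatrix_equiv_self (Equiv.ofBijective _ (nonzeroResidue_bijective n))]
  have h (i k : Fin (n - 1)) := shiftMinor_nonzeroResidue (n := n) (s := 1) (by omega) i k
  rw [Nat.cast_one] at h
  rw [Matrix.det_of_isUpperTriangular]
  · simp only [Matrix.submatrix_apply, Equiv.ofBijective_apply, h]
    refine Finset.prod_ne_zero_iff.2 fun i _ => ?_
    rw [if_neg (by omega)]
    simp
  · intro i k hki
    have hki' : k.1 < i.1 := hki
    simp only [Matrix.submatrix_apply, Equiv.ofBijective_apply, h]
    rw [if_neg (by omega), if_neg (by omega), sub_zero]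

theorem sum_mul_bidiagonal {N : ℕ} (g : ℕ → ℤ) (hg : g 0 = 0) (m : Fin N) :
    ∑ k : Fin N, g (k.1 + 1) * ((if m.1 = k.1 + 1 then 1 else 0) - (if m = k then 1 else 0)) =
      g m.1 - g (m.1 + 1) := by
  simp only [mul_sub, Finset.sum_sub_distrib]
  congr 1
  · rcases m with ⟨_ | a, hm⟩
    · simp [hg]
    · rw [Finset.sum_eq_single ⟨a, by omega⟩]
      · simp
      · intro b _ hb
        rw [if_neg fun h => hb (Fin.ext (Nat.succ.inj h).symm), mul_zero]
      · simp
  · simp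

theorem Amat_mul_shiftMinor_one {n p : ℕ} (hn : 2 ≤ n) (hp1 : 1 ≤ p) (hpn : p ≤ n - 1) :
    Amat n p * (shiftMinor n 1).submatrix (nonzeroResidue n) (nonzeroResidue n) =
      (shiftMinor n p).submatrix (nonzeroResidue n) (nonzeroResidue n) := by
  have h (i k : Fin (n - 1)) := shiftMinor_nonzeroResidue (n := n) (s := 1) (by omega) i k
  rw [Nat.cast_one] at h
  have h' (i k : Fin (n - 1)) : (k.1 = i.1 + 1 ∨ k.1 + n = i.1 + 1) ↔ k.1 = i.1 + 1 := by omega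
  ext j m
  simp only [Matrix.mul_apply, Matrix.submatrix_apply, h, h', Amat]
  rw [sum_mul_bidiagonal (Aent n p (j.1 + 1)), shiftMinor_nonzeroResidue (by omega)]
  · have hj := j.2
    have hm := m.2
    simp only [Aent, Fin.ext_iff]
    split_ifs <;> omega
  · simp only [Aent]
    split_ifs <;> omega

/-- `det A = 1`. -/
theorem stmt2 (n p : ℕ) (hn : 2 ≤ n) (hp1 : 1 ≤ p) (hpn : p ≤ n - 1)
    (hgcd : Nat.gcd n p = 1) :
    (Amat n p).det = 1 := by
  have : NeZero n := ⟨by omega⟩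
  let e := Equiv.ofBijective _ (nonzeroResidue_bijective n)
  have hdet := congrArg Matrix.det (Amat_mul_shiftMinor_one hn hp1 hpn)
  rw [Matrix.det_mul] at hdet
  have hu := det_shiftMinor_unit n (ZMod.unitOfCoprime p (Nat.coprime_comm.1 hgcd))
  rw [ZMod.coe_unitOfCoprime, ← Matrix.det_submatrix_equiv_self e (shiftMinor n p)] at hu
  refine mul_right_cancel₀ (det_shiftMinor_one_ne_zero n hn) ?_
  rw [one_mul, ← Matrix.det_submatrix_equiv_self e (shiftMinor n 1)]
  exact hdet.trans (hu.trans (Matrix.det_submatrix_equiv_self e _).symm)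

end
end

section
/- Let n ≥ 2 be an integer, p ∈ {1,…,n−1} with gcd(n,p) = 1, and q ∈ {1,…,n−1} with pq ≡ 1 (mod n). Then for every j with 1 ≤ j < n−p the matrix B satisfies: B_{j,j+p−1} = B_{j+p,j+p−1} + 1; B_{j,j+p} = B_{j+p,j+p} − 1; and B_{j,k} = B_{j+p,k} for every k ∈ {1,…,n−1} with k ≠ j+p−1 and k ≠ j+p. -/
open Finset Matrix
open scoped BigOperators Real

noncomputable section

/-- Since `q` inverts `p` modulo `n`, the zero pattern of `B` can be read off from the residue
of `q (k - m)` modulo `n`. -/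
theorem Bent_eq_ite_emod {n p q : ℕ} (hq1 : 1 ≤ q)
    (hpq : p * q ≡ 1 [MOD n]) (m k : ℕ) :
    Bent n p q m k =
      if 1 ≤ ((q : ℤ) * ((k : ℤ) - m)) % n ∧ ((q : ℤ) * ((k : ℤ) - m)) % n ≤ (n : ℤ) - q
      then 0 else 1 := by
  have hpq' : (p : ℤ) * q ≡ 1 [ZMOD n] := by
    exact_mod_cast (Int.natCast_modEq_iff).2 hpq
  unfold Bent
  refine if_congr ⟨?_, ?_⟩ rfl rfl
  · rintro ⟨ℓ, hℓ, h⟩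
    rw [Finset.mem_Icc] at hℓ
    have h1 : (q : ℤ) * ((k : ℤ) - m) ≡ ℓ [ZMOD n] := by
      calc (q : ℤ) * ((k : ℤ) - m) ≡ q * ((ℓ * p : ℕ) : ℤ) [ZMOD n] := h.mul_left _
        _ = ℓ * (p * q) := by push_cast; ring
        _ ≡ ℓ * 1 [ZMOD n] := hpq'.mul_left _
        _ = ℓ := mul_one _
    rw [h1.eq, Int.emod_eq_of_lt (by omega) (by omega)]
    omega
  · rintro ⟨h1, h2⟩
    refine ⟨(((q : ℤ) * ((k : ℤ) - m)) % n).toNat, ?_, ?_⟩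
    · rw [Finset.mem_Icc]
      omega
    · rw [Nat.cast_mul, Int.toNat_of_nonneg (by omega)]
      calc (k : ℤ) - m = 1 * ((k : ℤ) - m) := (one_mul _).symm
        _ ≡ p * q * ((k : ℤ) - m) [ZMOD n] := hpq'.symm.mul_right _
        _ = q * ((k : ℤ) - m) * p := by ring
        _ ≡ (q * ((k : ℤ) - m)) % n * p [ZMOD n] := (Int.mod_modEq _ _).symm.mul_right _

/-- Shifting the row by `p` lowers the residue of `q (k - m)` by one. -/
theorem mul_sub_add_modEq {n p q : ℕ} (hpq : p * q ≡ 1 [MOD n]) (m k : ℕ) :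
    (q : ℤ) * ((k : ℤ) - (m + p : ℕ)) ≡ (q * ((k : ℤ) - m)) % n - 1 [ZMOD n] := by
  have hpq' : (p : ℤ) * q ≡ 1 [ZMOD n] := by
    exact_mod_cast (Int.natCast_modEq_iff).2 hpq
  calc (q : ℤ) * ((k : ℤ) - (m + p : ℕ)) = q * ((k : ℤ) - m) - p * q := by push_cast; ring
    _ ≡ (q * ((k : ℤ) - m)) % n - 1 [ZMOD n] := (Int.mod_modEq _ _).symm.sub hpq'

/-- Two natural numbers below `n` agree if their multiples by the unit `q` agree modulo `n`. -/
theorem eq_of_mul_sub_modEq {n p q : ℕ} (hpq : p * q ≡ 1 [MOD n]) {m k k' : ℕ}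
    (hk : k < n) (hk' : k' < n)
    (h : (q : ℤ) * ((k : ℤ) - m) ≡ q * ((k' : ℤ) - m) [ZMOD n]) : k = k' := by
  have hpq' : (p : ℤ) * q ≡ 1 [ZMOD n] := by
    exact_mod_cast (Int.natCast_modEq_iff).2 hpq
  have key : (k : ℤ) ≡ k' [ZMOD n] := by
    calc (k : ℤ) = 1 * ((k : ℤ) - m) + m := by ring
      _ ≡ p * q * ((k : ℤ) - m) + m [ZMOD n] := (hpq'.symm.mul_right _).add_right _
      _ = p * (q * ((k : ℤ) - m)) + m := by ring
      _ ≡ p * (q * ((k' : ℤ) - m)) + m [ZMOD n] := (h.mul_left _).add_right _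
      _ = p * q * ((k' : ℤ) - m) + m := by ring
      _ ≡ 1 * ((k' : ℤ) - m) + m [ZMOD n] := (hpq'.mul_right _).add_right _
      _ = k' := by ring
  exact Nat.ModEq.eq_of_lt_of_lt (Int.natCast_modEq_iff.1 key) hk hk'

/-- For every `j` with `1 ≤ j < n-p`:
`B_{j,j+p-1} = B_{j+p,j+p-1} + 1`, `B_{j,j+p} = B_{j+p,j+p} - 1`, and
`B_{j,k} = B_{j+p,k}` for all `k ∈ {1, …, n-1}` with `k ≠ j+p-1`, `k ≠ j+p`. -/
theorem stmt3 (n p q : ℕ) (hn : 2 ≤ n) (hp1 : 1 ≤ p) (hpn : p ≤ n - 1)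
    (hgcd : Nat.gcd n p = 1) (hq1 : 1 ≤ q) (hqn : q ≤ n - 1)
    (hpq : p * q ≡ 1 [MOD n])
    (j : ℕ) (hj1 : 1 ≤ j) (hj2 : j < n - p) :
    Bent n p q j (j + p - 1) = Bent n p q (j + p) (j + p - 1) + 1 ∧
    Bent n p q j (j + p) = Bent n p q (j + p) (j + p) - 1 ∧
    (∀ k, 1 ≤ k → k ≤ n - 1 → k ≠ j + p - 1 → k ≠ j + p →
      Bent n p q j k = Bent n p q (j + p) k) := by
  have hpq' : (p : ℤ) * q ≡ 1 [ZMOD n] := by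
    exact_mod_cast (Int.natCast_modEq_iff).2 hpq
  have hB := Bent_eq_ite_emod (p := p) hq1 hpq
  have hr1 : ((q : ℤ) * (((j + p : ℕ) : ℤ) - j)) % n = 1 := by
    have : (q : ℤ) * (((j + p : ℕ) : ℤ) - j) = p * q := by push_cast; ring
    rw [this, hpq'.eq, Int.emod_eq_of_lt (by omega) (by omega)]
  have hs1 : (q : ℤ) * (((j + p - 1 : ℕ) : ℤ) - j) ≡ 1 - q [ZMOD n] := by
    have : (q : ℤ) * (((j + p - 1 : ℕ) : ℤ) - j) = p * q - q := by
      rw [Nat.cast_sub (by omega)]; push_cast; ring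
    rw [this]
    exact hpq'.sub_right _
  refine ⟨?_, ?_, ?_⟩
  · have h2 : (q : ℤ) * (((j + p - 1 : ℕ) : ℤ) - (j + p : ℕ)) ≡ n - q [ZMOD n] := by
      have : (q : ℤ) * (((j + p - 1 : ℕ) : ℤ) - (j + p : ℕ)) = (n - q) - n := by
        rw [Nat.cast_sub (by omega)]; push_cast; ring
      rw [this]
      exact Int.sub_modulus_modEq_iff.2 rfl
    rw [hB, hB, h2.eq, Int.emod_eq_of_lt (a := (n : ℤ) - q) (by omega) (by omega),
      if_neg, if_pos (by omega), zero_add]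
    rw [hs1.eq]
    rcases hq1.eq_or_lt with rfl | hq
    · simp
    · rw [← Int.add_emod_right, Int.emod_eq_of_lt (by omega) (by omega)]
      omega
  · rw [hB, hB, hr1, if_pos (by omega), if_neg, sub_self]
    simp
  · intro k hk1 hk2 hne1 hne2
    rw [hB, hB, (mul_sub_add_modEq hpq j k).eq]
    have hr0 : 0 ≤ ((q : ℤ) * ((k : ℤ) - j)) % n := Int.emod_nonneg _ (by omega)
    have hrn : ((q : ℤ) * ((k : ℤ) - j)) % n < n := Int.emod_lt_of_pos _ (by omega)
    have hrne1 : ((q : ℤ) * ((k : ℤ) - j)) % n ≠ 1 := fun h =>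
      hne2 (eq_of_mul_sub_modEq hpq (m := j) (by omega) (by omega) (h.trans hr1.symm))
    have hrneq : ¬ (q : ℤ) * ((k : ℤ) - j) ≡ 1 - q [ZMOD n] := fun h =>
      hne1 (eq_of_mul_sub_modEq hpq (m := j) (by omega) (by omega) (h.trans hs1.symm))
    have hrneq' : ((q : ℤ) * ((k : ℤ) - j)) % n ≠ n + 1 - q := by
      intro h
      refine hrneq ((Int.mod_modEq _ _).symm.trans ?_)
      rw [h, add_sub_assoc]
      exact Int.modulus_add_modEq_iff.2 rfl
    have hrq0 : ((q : ℤ) * ((k : ℤ) - j)) % n = 0 → q ≠ 1 := by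
      rintro h rfl
      exact hrneq ((Int.mod_modEq _ _).symm.trans (by rw [h]; simp))
    generalize ((q : ℤ) * ((k : ℤ) - j)) % n = r at *
    rcases hr0.eq_or_lt with rfl | hr
    · rw [← Int.add_emod_right, Int.emod_eq_of_lt (by omega) (by omega)]
      refine if_congr ?_ rfl rfl
      have := hrq0 rfl
      omega
    · rw [Int.emod_eq_of_lt (by omega) (by omega)]
      refine if_congr ?_ rfl rfl
      omega

end
end

section
/- Let n ≥ 2 be an integer, p ∈ {1,…,n−1} with gcd(n,p) = 1, and q ∈ {1,…,n−1} with pq ≡ 1 (mod n). Then the matrix Ω = B − C has the following boundary rows: Ω_{n−p,k} = 1 if k = n−1 and Ω_{n−p,k} = 0 for all other k ∈ {1,…,n−1}; if p = 1 then Ω_{1,k} = 1 if k = 1 and Ω_{1,k} = 0 otherwise; if p > 1 then Ω_{p,p} = 1, Ω_{p,p−1} = −1, and Ω_{p,k} = 0 for all k ∈ {1,…,n−1} with k ∉ {p−1,p}. -/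
open Finset Matrix
open scoped BigOperators Real

noncomputable section

/-- If `x ≡ r p (mod n)` with `0 ≤ r < n`, then `x` is a multiple `ℓ p` with `1 ≤ ℓ ≤ n - q`
modulo `n` exactly when `1 ≤ r ≤ n - q`. -/
theorem exists_modEq_mul_iff {n p q r : ℕ} (hgcd : Nat.gcd n p = 1) (hq1 : 1 ≤ q)
    (hr : r < n) {x : ℤ} (hx : x ≡ ((r * p : ℕ) : ℤ) [ZMOD (n : ℤ)]) :
    (∃ ℓ ∈ Finset.Icc 1 (n - q), x ≡ ((ℓ * p : ℕ) : ℤ) [ZMOD (n : ℤ)]) ↔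
      1 ≤ r ∧ r ≤ n - q := by
  constructor
  · rintro ⟨ℓ, hℓ, h⟩
    rw [Finset.mem_Icc] at hℓ
    have h1 : r * p ≡ ℓ * p [MOD n] := (Int.natCast_modEq_iff).1 (hx.symm.trans h)
    have h2 : r = ℓ :=
      (Nat.ModEq.cancel_right_of_coprime hgcd h1).eq_of_lt_of_lt hr (by omega)
    omega
  · exact fun h => ⟨r, Finset.mem_Icc.2 h, hx⟩

/-- Residues `a, b` modulo `n` agree iff their coefficients as multiples of `p` agree. -/
theorem eq_iff_eq_of_modEq_mul {n p a b r s : ℕ} (hgcd : Nat.gcd n p = 1)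
    (ha : a < n) (hb : b < n) (hr : r < n) (hs : s < n)
    (har : (a : ℤ) ≡ ((r * p : ℕ) : ℤ) [ZMOD (n : ℤ)])
    (hbs : (b : ℤ) ≡ ((s * p : ℕ) : ℤ) [ZMOD (n : ℤ)]) : a = b ↔ r = s := by
  rw [Int.natCast_modEq_iff] at har hbs
  constructor
  · rintro rfl
    exact (Nat.ModEq.cancel_right_of_coprime hgcd (har.symm.trans hbs)).eq_of_lt_of_lt hr hs
  · rintro rfl
    exact (har.trans hbs.symm).eq_of_lt_of_lt ha hb

/-- Entries of `Ω` in terms of the coefficients of `k - m` and `k` as multiples of `p`. -/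
theorem Ωent_eq_s4 {n p q m k r s : ℕ} (hgcd : Nat.gcd n p = 1) (hq1 : 1 ≤ q)
    (hr : r < n) (hs : s < n)
    (hkm : (k : ℤ) - (m : ℤ) ≡ ((s * p : ℕ) : ℤ) [ZMOD (n : ℤ)])
    (hk : (k : ℤ) ≡ ((r * p : ℕ) : ℤ) [ZMOD (n : ℤ)]) :
    Ωent n p q m k =
      (if 1 ≤ s ∧ s ≤ n - q then 0 else 1) - (if 1 ≤ r ∧ r ≤ n - q then 0 else 1) := by
  simp only [Ωent, Bent, Cent, exists_modEq_mul_iff hgcd hq1 hs hkm,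
    exists_modEq_mul_iff hgcd hq1 hr hk]

/-- Every nonzero residue modulo `n` is `r p` for some `1 ≤ r < n`. -/
theorem exists_pos_modEq_mul {n p q k : ℕ} (hk1 : 1 ≤ k) (hkn : k < n)
    (hpq : p * q ≡ 1 [MOD n]) :
    ∃ r, 1 ≤ r ∧ r < n ∧ (k : ℤ) ≡ ((r * p : ℕ) : ℤ) [ZMOD (n : ℤ)] := by
  have h : k ≡ (k * q % n) * p [MOD n] := by
    calc k = k * 1 := (mul_one k).symm
      _ ≡ k * (p * q) [MOD n] := (hpq.symm).mul_left k
      _ = k * q * p := by ring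
      _ ≡ (k * q % n) * p [MOD n] := (Nat.mod_modEq _ _).symm.mul_right p
  refine ⟨k * q % n, ?_, Nat.mod_lt _ (by omega), Int.natCast_modEq_iff.2 h⟩
  by_contra h0
  have h0' : k * q % n = 0 := by omega
  rw [h0', zero_mul] at h
  have := h.eq_of_lt_of_lt hkn (by omega)
  omega

/-- Row `n - p` of `Ω` is the unit vector supported at `n - 1`. -/
theorem Ωent_sub_row {n p q k : ℕ} (hpn : p ≤ n - 1)
    (hgcd : Nat.gcd n p = 1) (hq1 : 1 ≤ q) (hqn : q ≤ n - 1) (hpq : p * q ≡ 1 [MOD n])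
    (hk1 : 1 ≤ k) (hkn : k ≤ n - 1) :
    Ωent n p q (n - p) k = if k = n - 1 then 1 else 0 := by
  obtain ⟨r, hr1, hrn, hr⟩ := exists_pos_modEq_mul (k := k) hk1 (by omega) hpq
  have hpq' : (n : ℤ) ∣ 1 - p * q := by
    simpa using (Int.natCast_modEq_iff.2 hpq).dvd
  have hlast : ((n - 1 : ℕ) : ℤ) ≡ (((n - q) * p : ℕ) : ℤ) [ZMOD (n : ℤ)] := by
    rw [Int.modEq_iff_dvd]
    push_cast [Nat.cast_sub (show 1 ≤ n by omega), Nat.cast_sub (show q ≤ n by omega)]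
    obtain ⟨c, hc⟩ := hpq'
    exact ⟨p - 1 + c, by linear_combination hc⟩
  have hiff := eq_iff_eq_of_modEq_mul hgcd (by omega) (by omega) hrn (by omega) hr hlast
  obtain ⟨c, hc⟩ := hr.dvd
  push_cast at hc
  by_cases hr' : r + 1 < n
  · have hs : (k : ℤ) - ((n - p : ℕ) : ℤ) ≡ (((r + 1) * p : ℕ) : ℤ) [ZMOD (n : ℤ)] := by
      rw [Int.modEq_iff_dvd]
      push_cast [Nat.cast_sub (show p ≤ n by omega)]
      exact ⟨c + 1, by linear_combination hc⟩
    rw [Ωent_eq_s4 hgcd hq1 hrn hr' hs hr]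
    split_ifs <;> omega
  · have hs : (k : ℤ) - ((n - p : ℕ) : ℤ) ≡ ((0 * p : ℕ) : ℤ) [ZMOD (n : ℤ)] := by
      have hrn' : (n : ℤ) = r + 1 := by omega
      rw [Int.modEq_iff_dvd]
      push_cast [Nat.cast_sub (show p ≤ n by omega)]
      exact ⟨c + 1 - p, by linear_combination hc + (p : ℤ) * hrn'⟩
    rw [Ωent_eq_s4 hgcd hq1 hrn (by omega) hs hr]
    split_ifs <;> omega

/-- Row `p` of `Ω` has `1` at `p`, `-1` at `p - 1` (if this is a valid index), and `0` elsewhere. -/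
theorem Ωent_row {n p q k : ℕ} (hp1 : 1 ≤ p) (hpn : p ≤ n - 1)
    (hgcd : Nat.gcd n p = 1) (hq1 : 1 ≤ q) (hqn : q ≤ n - 1) (hpq : p * q ≡ 1 [MOD n])
    (hk1 : 1 ≤ k) (hkn : k ≤ n - 1) :
    Ωent n p q p k = if k = p then 1 else if k = p - 1 then -1 else 0 := by
  obtain ⟨r, hr1, hrn, hr⟩ := exists_pos_modEq_mul (k := k) hk1 (by omega) hpq
  have hpq' : (n : ℤ) ∣ 1 - p * q := by
    simpa using (Int.natCast_modEq_iff.2 hpq).dvd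
  have hp : (p : ℤ) ≡ ((1 * p : ℕ) : ℤ) [ZMOD (n : ℤ)] := by rw [one_mul]
  have hiff := eq_iff_eq_of_modEq_mul hgcd (by omega) (by omega) hrn (by omega) hr hp
  have hpred : ((p - 1 : ℕ) : ℤ) ≡ (((n - q + 1) * p : ℕ) : ℤ) [ZMOD (n : ℤ)] := by
    rw [Int.modEq_iff_dvd]
    push_cast [Nat.cast_sub hp1, Nat.cast_sub (show q ≤ n by omega)]
    obtain ⟨c, hc⟩ := hpq'
    exact ⟨p + c, by linear_combination hc⟩
  have hiff' : k = p - 1 ↔ r = n - q + 1 := by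
    rcases hq1.eq_or_lt with rfl | hq
    · have : p = 1 := by
        rw [mul_one] at hpq
        exact hpq.eq_of_lt_of_lt (by omega) (by omega)
      omega
    · exact eq_iff_eq_of_modEq_mul hgcd (by omega) (by omega) hrn (by omega) hr hpred
  have hs : (k : ℤ) - (p : ℤ) ≡ (((r - 1) * p : ℕ) : ℤ) [ZMOD (n : ℤ)] := by
    obtain ⟨c, hc⟩ := hr.dvd
    rw [Int.modEq_iff_dvd]
    push_cast [Nat.cast_sub hr1] at hc ⊢
    exact ⟨c, by linear_combination hc⟩
  rw [Ωent_eq_s4 hgcd hq1 hrn (by omega) hs hr]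
  split_ifs <;> omega

/-- Boundary rows of `Ω = B - C`: row `n-p` equals the unit vector
supported at `n-1`; if `p = 1` then row `1` is the unit vector supported at `1`;
if `p > 1` then row `p` has `Ω_{p,p} = 1`, `Ω_{p,p-1} = -1` and all other entries `0`. -/
theorem stmt4 (n p q : ℕ) (hn : 2 ≤ n) (hp1 : 1 ≤ p) (hpn : p ≤ n - 1)
    (hgcd : Nat.gcd n p = 1) (hq1 : 1 ≤ q) (hqn : q ≤ n - 1)
    (hpq : p * q ≡ 1 [MOD n]) :
    (∀ k, 1 ≤ k → k ≤ n - 1 → Ωent n p q (n - p) k = if k = n - 1 then 1 else 0) ∧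
    (p = 1 → ∀ k, 1 ≤ k → k ≤ n - 1 → Ωent n p q 1 k = if k = 1 then 1 else 0) ∧
    (1 < p → Ωent n p q p p = 1 ∧ Ωent n p q p (p - 1) = -1 ∧
      (∀ k, 1 ≤ k → k ≤ n - 1 → k ≠ p - 1 → k ≠ p → Ωent n p q p k = 0)) := by
  refine ⟨fun k hk1 hkn => Ωent_sub_row hpn hgcd hq1 hqn hpq hk1 hkn, ?_, fun hp => ?_⟩
  · rintro rfl k hk1 hkn
    rw [Ωent_row hp1 hpn hgcd hq1 hqn hpq hk1 hkn]
    split_ifs <;> omega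
  · refine ⟨?_, ?_, fun k hk1 hkn hk hk' => ?_⟩ <;>
      rw [Ωent_row hp1 hpn hgcd hq1 hqn hpq (by omega) (by omega)] <;> split_ifs <;> omega

end
end

section
/- Let n ≥ 2, p ∈ {1,…,n−1} with gcd(n,p) = 1, q ∈ {1,…,n−1} with pq ≡ 1 (mod n), and let y be a type (i) coupling. Then for every ξ ∈ A_y^+, every ℓ ∈ {1,…,n}, and every d ∈ {1,…,n−1}, the cyclic window sum s = ξ_ℓ + ξ_{ℓ+1} + ⋯ + ξ_{ℓ+d−1} satisfies 0 < s < π; moreover s < y whenever d < p, and s > y whenever d > p. -/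
open Finset Matrix
open scoped BigOperators Real

noncomputable section

theorem wsum_add (ξ : ℕ → ℝ) (j a b : ℕ) :
    wsum ξ j (a + b) = wsum ξ j a + wsum ξ (j + a) b := by
  simp [wsum, Finset.sum_range_add, add_assoc]

theorem wsum_one (ξ : ℕ → ℝ) (j : ℕ) : wsum ξ j 1 = ξ j := by
  simp [wsum]

theorem wsum_pos {ξ : ℕ → ℝ} (hpos : ∀ m, 0 < ξ m) (j : ℕ) {d : ℕ} (hd : 0 < d) :
    0 < wsum ξ j d :=
  Finset.sum_pos (fun _ _ => hpos _) (Finset.nonempty_range_iff.2 hd.ne')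

theorem wsum_strictMono {ξ : ℕ → ℝ} (hpos : ∀ m, 0 < ξ m) (j : ℕ) :
    StrictMono (wsum ξ j) := by
  intro a b hab
  obtain ⟨c, rfl⟩ := Nat.exists_eq_add_of_le hab.le
  rw [wsum_add]
  have := wsum_pos hpos (j + a) (d := c) (by omega)
  linarith

section Periodic

variable {n : ℕ} {ξ : ℕ → ℝ}

theorem wsum_add_period_mul (hper : Function.Periodic ξ n) (j k d : ℕ) :
    wsum ξ (j + k * n) d = wsum ξ j d := by
  refine Finset.sum_congr rfl fun m _ => ?_
  rw [add_right_comm]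
  exact hper.nat_mul k (j + m)

theorem wsum_period (hper : Function.Periodic ξ n) (j : ℕ) :
    wsum ξ j n = ∑ k ∈ Finset.Icc 1 n, ξ k := by
  have hone : wsum ξ 1 n = ∑ k ∈ Finset.Icc 1 n, ξ k := by
    rw [← Finset.Ico_add_one_right_eq_Icc, Finset.sum_Ico_eq_sum_range]
    simp [wsum]
  have hstep : ∀ i, wsum ξ (i + 1) n = wsum ξ i n := fun i => by
    have h := wsum_add ξ i 1 n
    rw [add_comm 1 n, wsum_add, wsum_one, wsum_one, hper i] at h
    linarith
  have hzero : ∀ i, wsum ξ i n = wsum ξ 0 n := fun i => by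
    induction i with
    | zero => rfl
    | succ i ih => rw [hstep, ih]
  rw [hzero, ← hone, hzero 1]

theorem wsum_period_mul (hper : Function.Periodic ξ n) (j k : ℕ) :
    wsum ξ j (k * n) = k * ∑ i ∈ Finset.Icc 1 n, ξ i := by
  induction k with
  | zero => simp [wsum]
  | succ k ih =>
    rw [Nat.add_mul, one_mul, wsum_add, ih, wsum_period hper]
    push_cast
    ring

/-- If all windows of length `p + 1` are at least `y` and `r + 1` consecutive ones wrap `k` times
around the period with an overlap of one term, then windows of length `p` stay below `y`. -/
theorem wsum_lt_of_forall_le_wsum {p r k : ℕ} {y : ℝ} (hper : Function.Periodic ξ n)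
    (hr : (r + 1) * (p + 1) = k * n + 1) (hle : ∀ j, y ≤ wsum ξ j (p + 1))
    (hy : k * ∑ i ∈ Finset.Icc 1 n, ξ i < (r + 1) * y) (ℓ : ℕ) :
    wsum ξ ℓ p < y := by
  have hmul : ∀ r j : ℕ, r * y ≤ wsum ξ j (r * (p + 1)) := fun r j => by
    induction r with
    | zero => simp [wsum]
    | succ r ih =>
      rw [Nat.add_mul, one_mul, wsum_add]
      push_cast
      linarith [hle (j + r * (p + 1))]
  have hcover : wsum ξ (ℓ + p) (r * (p + 1)) + wsum ξ ℓ (p + 1) =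
      k * ∑ i ∈ Finset.Icc 1 n, ξ i + ξ (ℓ + p) := by
    rw [← wsum_add_period_mul hper ℓ k (p + 1),
      show ℓ + k * n = ℓ + p + r * (p + 1) by linarith, ← wsum_add,
      show r * (p + 1) + (p + 1) = k * n + 1 by linarith, wsum_add, wsum_period_mul hper,
      wsum_add_period_mul hper, wsum_one]
  rw [wsum_add, wsum_one] at hcover
  linarith [hmul r (ℓ + p)]

/-- If all windows of length `p` are at most `y` and `r + 1` consecutive ones miss a single term
when wrapping `k` times around the period, then windows of length `p + 1` stay above `y`. -/
theorem lt_wsum_of_forall_wsum_le {p r k : ℕ} {y : ℝ} (hper : Function.Periodic ξ n)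
    (hr : (r + 1) * p + 1 = k * n) (hle : ∀ j, wsum ξ j p ≤ y)
    (hy : (r + 1) * y < k * ∑ i ∈ Finset.Icc 1 n, ξ i) (ℓ : ℕ) :
    y < wsum ξ ℓ (p + 1) := by
  have hmul : ∀ r j : ℕ, wsum ξ j (r * p) ≤ r * y := fun r j => by
    induction r with
    | zero => simp [wsum]
    | succ r ih =>
      rw [Nat.add_mul, one_mul, wsum_add]
      push_cast
      linarith [hle (j + r * p)]
  have hcover : ξ (ℓ + p) + wsum ξ (ℓ + p + 1) (r * p) + wsum ξ ℓ p =
      k * ∑ i ∈ Finset.Icc 1 n, ξ i := by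
    rw [← wsum_add_period_mul hper ℓ k p,
      show ℓ + k * n = ℓ + p + (1 + r * p) by linarith, ← wsum_one ξ (ℓ + p), ← wsum_add,
      ← wsum_add, show 1 + r * p + p = k * n by linarith, wsum_period_mul hper]
  rw [wsum_add, wsum_one]
  linarith [hmul r (ℓ + p + 1)]

/-- A property that holds on `1, …, n` and is invariant under shifts by `n` holds everywhere. -/
theorem forall_of_forall_mem_Icc_period {P : ℕ → Prop} (hn : 0 < n)
    (hP : ∀ m, P (m + n) ↔ P m) (h : ∀ k, 1 ≤ k → k ≤ n → P k) (m : ℕ) : P m := by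
  induction m using Nat.strong_induction_on with
  | _ m ih =>
    rcases Nat.eq_zero_or_pos m with rfl | hm
    · rw [← hP, Nat.zero_add]
      exact h n hn le_rfl
    · rcases le_or_gt m n with hmn | hmn
      · exact h m hm hmn
      · rw [← Nat.sub_add_cancel hmn.le, hP]
        exact ih _ (by omega)

end Periodic

/-- For `ξ ∈ A_y^+`, every cyclic window sum
`s = ξ_ℓ + ⋯ + ξ_{ℓ+d-1}` with `ℓ ∈ {1, …, n}`, `d ∈ {1, …, n-1}` satisfies
`0 < s < π`; moreover `s < y` if `d < p` and `s > y` if `d > p`. -/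
theorem stmt8 (n p q : ℕ) (hn : 2 ≤ n) (hp1 : 1 ≤ p) (hpn : p ≤ n - 1)
    (hgcd : Nat.gcd n p = 1) (hq1 : 1 ≤ q) (hqn : q ≤ n - 1)
    (hpq : p * q ≡ 1 [MOD n])
    (y : ℝ) (hy : typeI1 n p q y ∨ typeI2 n p q y)
    (ξ : ℕ → ℝ) (hξ : inAy n p y ξ)
    (ℓ d : ℕ) (hℓ1 : 1 ≤ ℓ) (hℓn : ℓ ≤ n) (hd1 : 1 ≤ d) (hdn : d ≤ n - 1) :
    (0 < wsum ξ ℓ d ∧ wsum ξ ℓ d < Real.pi) ∧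
    (d < p → wsum ξ ℓ d < y) ∧
    (p < d → y < wsum ξ ℓ d) := by
  obtain ⟨hper, hpos₀, hsum, hwin₀⟩ := hξ
  replace hper : Function.Periodic ξ n := hper
  have hpos : ∀ m, 0 < ξ m :=
    forall_of_forall_mem_Icc_period (by omega) (fun m => by rw [hper m]) hpos₀
  have hwin : ∀ m, 0 < Real.sign (Mval n p y) * (wsum ξ m p - y) := by
    refine forall_of_forall_mem_Icc_period (by omega) (fun m => ?_) hwin₀
    have h := wsum_add_period_mul hper m 1 p
    rw [one_mul] at h
    rw [h]
  have hmono : ∀ j, StrictMono (wsum ξ j) := wsum_strictMono hpos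
  have hn0 : (0 : ℝ) < n := by exact_mod_cast (by omega : 0 < n)
  refine ⟨⟨wsum_pos hpos ℓ (by omega), ?_⟩, ?_⟩
  · rw [← hsum, ← wsum_period hper ℓ]
    exact hmono ℓ (by omega)
  obtain ⟨k, hk⟩ : ∃ k, p * q = k * n + 1 := by
    have hpos_pq : 1 ≤ p * q := Nat.mul_pos hp1 hq1
    obtain ⟨k, hk⟩ := (Nat.modEq_iff_dvd' hpos_pq).1 hpq.symm
    exact ⟨k, by rw [mul_comm k n]; omega⟩
  have hkR : (p : ℝ) * q = k * n + 1 := by exact_mod_cast hk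
  rcases hy with ⟨hy1, hy2⟩ | ⟨hy1, hy2⟩
  · have hM : 0 < Mval n p y := by
      rw [lt_div_iff₀ hn0] at hy2
      unfold Mval
      linarith
    have hle : ∀ j, y < wsum ξ j p := fun j => by
      have h := hwin j
      rw [Real.sign_of_pos hM] at h
      linarith
    refine ⟨fun hd => ?_, fun hd => (hle ℓ).trans (hmono ℓ hd)⟩
    obtain ⟨p, rfl⟩ := Nat.exists_eq_add_of_le' hp1
    obtain ⟨r, rfl⟩ := Nat.exists_eq_add_of_le' hq1
    refine ((hmono ℓ).monotone (Nat.le_of_lt_succ hd)).trans_lt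
      (wsum_lt_of_forall_le_wsum hper (k := k) (r := r) (by rw [mul_comm, hk])
        (fun j => (hle j).le) ?_ ℓ)
    rw [hsum]
    have hq0 : (0 : ℝ) < ((r + 1 : ℕ) : ℝ) := by positivity
    have hcoef : (((p + 1 : ℕ) : ℝ) / n - 1 / ((n : ℝ) * ((r + 1 : ℕ) : ℝ))) =
        k / ((r + 1 : ℕ) : ℝ) := by
      field_simp
      linarith
    rw [hcoef, div_mul_eq_mul_div, div_lt_iff₀ hq0] at hy1
    push_cast at hy1
    linarith
  · have hM : Mval n p y < 0 := by
      rw [div_lt_iff₀ hn0] at hy1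
      unfold Mval
      linarith
    have hle : ∀ j, wsum ξ j p < y := fun j => by
      have h := hwin j
      rw [Real.sign_of_neg hM] at h
      linarith
    refine ⟨fun hd => (hmono ℓ hd).trans (hle ℓ), fun hd => ?_⟩
    obtain ⟨r, hr⟩ : ∃ r, n = q + (r + 1) := ⟨n - q - 1, by omega⟩
    have hkp : k < p := by
      by_contra! h
      nlinarith [Nat.mul_le_mul h (by omega : q + 1 ≤ n)]
    obtain ⟨m, hm⟩ := Nat.exists_eq_add_of_le hkp.le
    have hcov : (r + 1) * p + 1 = m * n := by
      have h : p * n = p * q + (r + 1) * p := by rw [hr]; ring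
      have h' : p * n = k * n + m * n := by rw [hm]; ring
      omega
    have hcovR : ((r : ℝ) + 1) * p + 1 = m * n := by exact_mod_cast hcov
    refine (lt_wsum_of_forall_wsum_le hper hcov (fun j => (hle j).le) ?_ ℓ).trans_le
      ((hmono ℓ).monotone hd)
    rw [hsum]
    have hr0 : (0 : ℝ) < (r : ℝ) + 1 := by positivity
    have hnq : (n : ℝ) - q = r + 1 := by
      rw [hr]
      push_cast
      ring
    have hcoef : (p : ℝ) / n + 1 / ((n : ℝ) * ((n : ℝ) - q)) = m / ((r : ℝ) + 1) := by
      rw [hnq]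
      field_simp
      linarith
    rw [hcoef, div_mul_eq_mul_div, lt_div_iff₀ hr0] at hy2
    linarith

end
end

section
/- Let n ≥ 2, p ∈ {1,…,n−1} with gcd(n,p) = 1, q ∈ {1,…,n−1} with pq ≡ 1 (mod n), and let y be a type (i) coupling with M = pπ − ny. Then |M| < π, sin(ny) ≠ 0, and sgn(sin(ny)) = (−1)^{p−1}·sgn(M). -/
open Finset Matrix
open scoped BigOperators Real

noncomputable section

/-- A bound on `|x|` by `π` makes `sin x` carry the sign of `x`. -/
theorem sign_sin_of_abs_lt_pi {x : ℝ} (hx : |x| < Real.pi) :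
    Real.sign (Real.sin x) = Real.sign x := by
  obtain ⟨h1, h2⟩ := abs_lt.mp hx
  rcases lt_trichotomy x 0 with h | rfl | h
  · rw [Real.sign_of_neg h, Real.sign_of_neg (Real.sin_neg_of_neg_of_neg_pi_lt h h1)]
  · simp
  · rw [Real.sign_of_pos h, Real.sign_of_pos (Real.sin_pos_of_pos_of_lt_pi h h2)]

theorem sign_neg_one_pow_mul (k : ℕ) (x : ℝ) :
    Real.sign ((-1 : ℝ) ^ k * x) = (-1 : ℝ) ^ k * Real.sign x := by
  rcases neg_one_pow_eq_or ℝ k with h | h <;> simp [h, Real.sign_neg]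

theorem sin_mul_eq_neg_one_pow_mul_sin_Mval (n p : ℕ) (hp1 : 1 ≤ p) (y : ℝ) :
    Real.sin ((n : ℝ) * y) = (-1 : ℝ) ^ (p - 1) * Real.sin (Mval n p y) := by
  obtain ⟨k, rfl⟩ := Nat.exists_eq_add_of_le' hp1
  have h : (n : ℝ) * y = ((k + 1 : ℕ) : ℝ) * Real.pi - Mval n (k + 1) y := by
    unfold Mval; ring
  rw [h, Real.sin_nat_mul_pi_sub, Nat.add_sub_cancel, pow_succ]
  ring

theorem Mval_pos_and_lt_pi_of_typeI1 {n p q : ℕ} (hn : 0 < n) (hq1 : 1 ≤ q) {y : ℝ}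
    (hy : typeI1 n p q y) : 0 < Mval n p y ∧ Mval n p y < Real.pi := by
  obtain ⟨h1, h2⟩ := hy
  have hn' : (0 : ℝ) < n := by exact_mod_cast hn
  have hq : (1 : ℝ) ≤ q := by exact_mod_cast hq1
  have e : (n : ℝ) * (((p : ℝ) / n - 1 / ((n : ℝ) * q)) * Real.pi)
      = p * Real.pi - Real.pi / q := by field_simp
  have h3 := mul_lt_mul_of_pos_left h1 hn'
  rw [e] at h3
  rw [lt_div_iff₀ hn'] at h2
  have h4 : Real.pi / q ≤ Real.pi := div_le_self Real.pi_pos.le hq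
  unfold Mval
  constructor <;> linarith

theorem Mval_neg_and_neg_pi_lt_of_typeI2 {n p q : ℕ} (hn : 0 < n) (hqn : q + 1 ≤ n) {y : ℝ}
    (hy : typeI2 n p q y) : Mval n p y < 0 ∧ -Real.pi < Mval n p y := by
  obtain ⟨h1, h2⟩ := hy
  have hn' : (0 : ℝ) < n := by exact_mod_cast hn
  have hq' : (q : ℝ) + 1 ≤ n := by exact_mod_cast hqn
  have hq : (1 : ℝ) ≤ (n : ℝ) - q := by linarith
  have hq0 : (n : ℝ) - q ≠ 0 := by linarith
  have e : (n : ℝ) * (((p : ℝ) / n + 1 / ((n : ℝ) * ((n : ℝ) - q))) * Real.pi)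
      = p * Real.pi + Real.pi / ((n : ℝ) - q) := by field_simp
  have h3 := mul_lt_mul_of_pos_left h2 hn'
  rw [e] at h3
  rw [div_lt_iff₀ hn'] at h1
  have h4 : Real.pi / ((n : ℝ) - q) ≤ Real.pi := div_le_self Real.pi_pos.le hq
  unfold Mval
  constructor <;> linarith

/-- For a type (i) coupling, `|M| < π`, `sin(ny) ≠ 0`, and
`sgn(sin(ny)) = (-1)^{p-1} sgn(M)`. -/
theorem stmt9 (n p q : ℕ) (hn : 2 ≤ n) (hp1 : 1 ≤ p) (hpn : p ≤ n - 1)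
    (hgcd : Nat.gcd n p = 1) (hq1 : 1 ≤ q) (hqn : q ≤ n - 1)
    (hpq : p * q ≡ 1 [MOD n])
    (y : ℝ) (hy : typeI1 n p q y ∨ typeI2 n p q y) :
    |Mval n p y| < Real.pi ∧
    Real.sin ((n : ℝ) * y) ≠ 0 ∧
    Real.sign (Real.sin ((n : ℝ) * y)) = (-1 : ℝ) ^ (p - 1) * Real.sign (Mval n p y) := by
  have hM : |Mval n p y| < Real.pi ∧ Mval n p y ≠ 0 := by
    rw [abs_lt]
    rcases hy with hy | hy
    · obtain ⟨h1, h2⟩ := Mval_pos_and_lt_pi_of_typeI1 (by omega) hq1 hy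
      exact ⟨⟨by linarith [Real.pi_pos], h2⟩, h1.ne'⟩
    · obtain ⟨h1, h2⟩ := Mval_neg_and_neg_pi_lt_of_typeI2 (by omega) (by omega) hy
      exact ⟨⟨h2, by linarith [Real.pi_pos]⟩, h1.ne⟩
  have hsign : Real.sign (Real.sin ((n : ℝ) * y))
      = (-1 : ℝ) ^ (p - 1) * Real.sign (Mval n p y) := by
    rw [sin_mul_eq_neg_one_pow_mul_sin_Mval n p hp1, sign_neg_one_pow_mul,
      sign_sin_of_abs_lt_pi hM.1]
  refine ⟨hM.1, fun h0 => ?_, hsign⟩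
  rw [h0, Real.sign_zero, eq_comm, mul_eq_zero, Real.sign_eq_zero_iff] at hsign
  exact hsign.elim (pow_ne_zero _ (by norm_num)) hM.2

end
end
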